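/- Let the following hold: (A1)(i) for every t ∈ [0,τ] the set 𝔙₁(t) of maximisers of 𝒢(t,·) over 𝔙₁ is nonempty; (A1)(ii) for every x ∈ 𝔙₁(0) the limit ∂ℓ𝒢(0⁺,x) := lim_{t↓0} [𝒢(t,x) − 𝒢(0,x)]/ℓ(t) exists; (A2) for every null sequence (t_n) in (0,τ] and every sequence (x_{t_n}) with x_{t_n} ∈ 𝔙₁(t_n), there exist a subsequence (t_{n_k}) and an element x₀ ∈ 𝔙₁(0) such that lim_{k→∞} [𝒢(t_{n_k}, x_{t_{n_k}}) − 𝒢(0, x_{t_{n_k}})]/ℓ(t_{n_k}) = ∂ℓ𝒢(0⁺,x₀). Then the limit L := lim_{t↓0} [g₁(t) − g₁(0)]/ℓ(t) exists, there is x* ∈ 𝔙₁(0) with L = ∂ℓ𝒢(0⁺,x*), and L ≥ ∂ℓ𝒢(0⁺,x) for every x ∈ 𝔙₁(0); that is, d g₁/dℓ(0⁺) = max_{x ∈ 𝔙₁(0)} ∂ℓ𝒢(0⁺,x). -/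

import Mathlib

open Filter Set

/-- Danskin-type lemma on differentiability of the maximum function
`g₁(t) = sup_{x ∈ 𝔙₁} 𝒢(t,x)` under assumptions (A1)(i),(ii) and (A2). -/
theorem stmt_1
    {V₁ : Type*} [Nonempty V₁]
    (τ : ℝ) (hτ : 0 < τ)
    (calG : ℝ → V₁ → ℝ)
    (ℓ : ℝ → ℝ) (hℓ0 : ℓ 0 = 0) (hℓpos : ∀ t ∈ Ioc (0 : ℝ) τ, 0 < ℓ t)
    -- 𝔙₁(t): set of maximisers of 𝒢(t,·)
    (Vmax : ℝ → Set V₁)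
    (hVmax : ∀ t : ℝ, Vmax t = { x : V₁ | ∀ x' : V₁, calG t x' ≤ calG t x })
    -- (A1)(i)
    (hA1i : ∀ t ∈ Icc (0 : ℝ) τ, (Vmax t).Nonempty)
    -- (A1)(ii): for x ∈ 𝔙₁(0) the limit ∂ℓ𝒢(0⁺,x) =: dG x exists
    (dG : V₁ → ℝ)
    (hA1ii : ∀ x ∈ Vmax 0,
        Tendsto (fun t => (calG t x - calG 0 x) / ℓ t)
          (nhdsWithin 0 (Ioi 0)) (nhds (dG x)))
    -- (A2)
    (hA2 : ∀ (tn : ℕ → ℝ) (xn : ℕ → V₁),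
        (∀ n, tn n ∈ Ioc (0 : ℝ) τ) → Tendsto tn atTop (nhds 0) →
        (∀ n, xn n ∈ Vmax (tn n)) →
        ∃ (φ : ℕ → ℕ) (x0 : V₁), StrictMono φ ∧ x0 ∈ Vmax 0 ∧
          Tendsto (fun k => (calG (tn (φ k)) (xn (φ k)) - calG 0 (xn (φ k))) / ℓ (tn (φ k)))
            atTop (nhds (dG x0)))
    -- g₁(t) = sup_{x ∈ 𝔙₁} 𝒢(t,x), attained at each maximiser
    (g₁ : ℝ → ℝ)
    (hg₁ : ∀ t ∈ Icc (0 : ℝ) τ, ∀ x ∈ Vmax t, g₁ t = calG t x) :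
    ∃ L : ℝ,
      Tendsto (fun t => (g₁ t - g₁ 0) / ℓ t) (nhdsWithin 0 (Ioi 0)) (nhds L) ∧
      (∃ xstar ∈ Vmax 0, L = dG xstar) ∧
      ∀ x ∈ Vmax 0, dG x ≤ L := by
  have mem_Icc {t : ℝ} (ht : t ∈ Ioc (0 : ℝ) τ) : t ∈ Icc (0 : ℝ) τ := Ioc_subset_Icc_self ht
  have zero_mem : (0 : ℝ) ∈ Icc (0 : ℝ) τ := ⟨le_rfl, hτ.le⟩
  have calG_le {t : ℝ} (ht : t ∈ Icc (0 : ℝ) τ) (x : V₁) : calG t x ≤ g₁ t := by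
    obtain ⟨y, hy⟩ := hA1i t ht
    rw [hg₁ t ht y hy]
    rw [hVmax] at hy
    exact hy x
  have lower {t : ℝ} (ht : t ∈ Ioc (0 : ℝ) τ) {x : V₁} (hx : x ∈ Vmax 0) :
      (calG t x - calG 0 x) / ℓ t ≤ (g₁ t - g₁ 0) / ℓ t := by
    rw [hg₁ 0 zero_mem x hx]
    have := calG_le (mem_Icc ht) x
    have := hℓpos t ht
    gcongr
  have upper {t : ℝ} (ht : t ∈ Ioc (0 : ℝ) τ) {x : V₁} (hx : x ∈ Vmax t) :
      (g₁ t - g₁ 0) / ℓ t ≤ (calG t x - calG 0 x) / ℓ t := by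
    rw [hg₁ t (mem_Icc ht) x hx]
    have := calG_le zero_mem x
    have := hℓpos t ht
    gcongr
  -- Along a subsequence of any null sequence the quotients converge to a maximal value of `dG`.
  have subseq (ns : ℕ → ℝ) (hns : Tendsto ns atTop (nhdsWithin 0 (Ioi 0))) :
      ∃ (ms : ℕ → ℕ) (x₀ : V₁), x₀ ∈ Vmax 0 ∧ (∀ x ∈ Vmax 0, dG x ≤ dG x₀) ∧
        Tendsto (fun n => (g₁ (ns (ms n)) - g₁ 0) / ℓ (ns (ms n))) atTop (nhds (dG x₀)) := by
    obtain ⟨N, hN⟩ := eventually_atTop.1 (hns.eventually (Ioc_mem_nhdsGT hτ))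
    have hmem (n : ℕ) : ns (n + N) ∈ Ioc (0 : ℝ) τ := hN _ (Nat.le_add_left N n)
    have hlim : Tendsto (fun n => ns (n + N)) atTop (nhdsWithin 0 (Ioi 0)) :=
      hns.comp (tendsto_add_atTop_nat N)
    choose xn hxn using fun n => hA1i _ (mem_Icc (hmem n))
    obtain ⟨φ, x₀, hφ, hx₀, hup⟩ :=
      hA2 _ xn hmem (hlim.mono_right nhdsWithin_le_nhds) hxn
    have hlow (x : V₁) (hx : x ∈ Vmax 0) :=
      (hA1ii x hx).comp (hlim.comp hφ.tendsto_atTop)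
    have hq : Tendsto (fun k => (g₁ (ns (φ k + N)) - g₁ 0) / ℓ (ns (φ k + N))) atTop
        (nhds (dG x₀)) :=
      tendsto_of_tendsto_of_tendsto_of_le_of_le (hlow x₀ hx₀) hup
        (fun k => lower (hmem (φ k)) hx₀) (fun k => upper (hmem (φ k)) (hxn (φ k)))
    exact ⟨fun k => φ k + N, x₀, hx₀,
      fun x hx => le_of_tendsto_of_tendsto' (hlow x hx) hq fun k => lower (hmem (φ k)) hx, hq⟩
  obtain ⟨ns, hns⟩ := exists_seq_tendsto (nhdsWithin (0 : ℝ) (Ioi 0))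
  obtain ⟨-, xstar, hxstar, hmax, -⟩ := subseq ns hns
  refine ⟨dG xstar, tendsto_of_subseq_tendsto fun ns hns => ?_, ⟨xstar, hxstar, rfl⟩, hmax⟩
  obtain ⟨ms, x₀, hx₀, hmax₀, hq⟩ := subseq ns hns
  exact ⟨ms, le_antisymm (hmax x₀ hx₀) (hmax₀ xstar hxstar) ▸ hq⟩
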